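/- Let (A, c) be a braided vector space with c² = id, and let m: A ⊗ A → A be an associative multiplication that commutes with the braiding, i.e., c(m ⊗ id) = (id ⊗ m)(c ⊗ id)(id ⊗ c) and c(id ⊗ m) = (m ⊗ id)(id ⊗ c)(c ⊗ id) as maps A ⊗ A ⊗ A → A ⊗ A. Then the braided commutator [·,·]_c := m ∘ (id − c) makes (A, [·,·]_c, c) a braided Lie algebra; that is, [·,·]_c satisfies the compatibility, anticommutativity, and Jacobi identities. -/

import Mathlib

/-!
STATEMENT 12: Let (A, c) be a braided vector space with c² = id, and let m : A ⊗ A → A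
be an associative multiplication that commutes with the braiding.  Then the braided
commutator [·,·]_c := m ∘ (id − c) makes (A, [·,·]_c, c) a braided Lie algebra.
-/

open TensorProduct

namespace Rigidity

variable (k A : Type*) [Field k] [AddCommGroup A] [Module k A]

/-- The operator `c ⊗ id` acting on `(A ⊗ A) ⊗ A`. -/
noncomputable def c12 (c : A ⊗[k] A →ₗ[k] A ⊗[k] A) :
    (A ⊗[k] A) ⊗[k] A →ₗ[k] (A ⊗[k] A) ⊗[k] A :=
  LinearMap.rTensor A c

/-- The operator `id ⊗ c` acting on `(A ⊗ A) ⊗ A` (via the associator). -/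
noncomputable def c23 (c : A ⊗[k] A →ₗ[k] A ⊗[k] A) :
    (A ⊗[k] A) ⊗[k] A →ₗ[k] (A ⊗[k] A) ⊗[k] A :=
  (TensorProduct.assoc k A A A).symm.toLinearMap ∘ₗ
    LinearMap.lTensor A c ∘ₗ (TensorProduct.assoc k A A A).toLinearMap

theorem stmt_12 [CharZero k]
    (c : A ⊗[k] A →ₗ[k] A ⊗[k] A)
    -- `c` is a symmetric braiding (hence in particular a linear isomorphism):
    (hsym : c ∘ₗ c = LinearMap.id)
    (hbraid : c12 k A c ∘ₗ c23 k A c ∘ₗ c12 k A c = c23 k A c ∘ₗ c12 k A c ∘ₗ c23 k A c)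
    (m : A ⊗[k] A →ₗ[k] A)
    -- associativity of `m`:
    (hassoc : m ∘ₗ LinearMap.rTensor A m
      = m ∘ₗ LinearMap.lTensor A m ∘ₗ (TensorProduct.assoc k A A A).toLinearMap)
    -- `c (m ⊗ id) = (id ⊗ m)(c ⊗ id)(id ⊗ c)`:
    (hcm₁ : c ∘ₗ LinearMap.rTensor A m
      = (LinearMap.lTensor A m ∘ₗ (TensorProduct.assoc k A A A).toLinearMap) ∘ₗ
          c12 k A c ∘ₗ c23 k A c)
    -- `c (id ⊗ m) = (m ⊗ id)(id ⊗ c)(c ⊗ id)`: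
    (hcm₂ : c ∘ₗ LinearMap.lTensor A m ∘ₗ (TensorProduct.assoc k A A A).toLinearMap
      = (LinearMap.rTensor A m) ∘ₗ c23 k A c ∘ₗ c12 k A c) :
    -- the braided commutator:
    ∀ br : A ⊗[k] A →ₗ[k] A, br = m ∘ₗ (LinearMap.id - c) →
      -- compatibility:
      (c ∘ₗ LinearMap.rTensor A br
        = (LinearMap.lTensor A br ∘ₗ (TensorProduct.assoc k A A A).toLinearMap) ∘ₗ
            c12 k A c ∘ₗ c23 k A c) ∧
      -- anticommutativity:
      (br ∘ₗ (LinearMap.id + c) = 0) ∧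
      -- Jacobi identity:
      (br ∘ₗ LinearMap.rTensor A br ∘ₗ
        (LinearMap.id + c12 k A c ∘ₗ c23 k A c + c23 k A c ∘ₗ c12 k A c) = 0) := by
  rintro br rfl
  have hc (x) : c (c x) = x := LinearMap.congr_fun hsym x
  have hP (x) : c12 k A c (c12 k A c x) = x := by
    simp only [c12, ← LinearMap.rTensor_comp_apply, hsym, LinearMap.rTensor_id_apply]
  have hQ (x) : c23 k A c (c23 k A c x) = x := by
    simp only [c23, LinearMap.comp_apply, LinearEquiv.coe_coe, LinearEquiv.apply_symm_apply,
      ← LinearMap.lTensor_comp_apply, hsym, LinearMap.lTensor_id_apply,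
      LinearEquiv.symm_apply_apply]
  have hQPQ (x) : c23 k A c (c12 k A c (c23 k A c x)) = c12 k A c (c23 k A c (c12 k A c x)) :=
    (LinearMap.congr_fun hbraid x).symm
  have ha (x) : m (LinearMap.lTensor A m (TensorProduct.assoc k A A A x))
      = m (LinearMap.rTensor A m x) := (LinearMap.congr_fun hassoc x).symm
  have hcm (x) : c (LinearMap.rTensor A m x)
      = LinearMap.lTensor A m (TensorProduct.assoc k A A A (c12 k A c (c23 k A c x))) :=
    LinearMap.congr_fun hcm₁ x
  have hbr_left (x) : LinearMap.rTensor A (m ∘ₗ (LinearMap.id - c)) x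
      = LinearMap.rTensor A m x - LinearMap.rTensor A m (c12 k A c x) := by
    simp only [c12, LinearMap.rTensor_comp_apply, LinearMap.rTensor_sub, LinearMap.sub_apply,
      LinearMap.rTensor_id_apply, map_sub]
  have hbr_right (x) : LinearMap.lTensor A (m ∘ₗ (LinearMap.id - c)) (TensorProduct.assoc k A A A x)
      = LinearMap.lTensor A m (TensorProduct.assoc k A A A x)
        - LinearMap.lTensor A m (TensorProduct.assoc k A A A (c23 k A c x)) := by
    simp only [c23, LinearMap.comp_apply, LinearEquiv.coe_coe, LinearEquiv.apply_symm_apply,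
      LinearMap.lTensor_comp_apply, LinearMap.lTensor_sub, LinearMap.sub_apply,
      LinearMap.lTensor_id_apply, map_sub]
  refine ⟨LinearMap.ext fun x => ?_, LinearMap.ext fun x => ?_, LinearMap.ext fun x => ?_⟩
  · simp only [LinearMap.comp_apply, LinearEquiv.coe_coe, hbr_left, hbr_right, map_sub, hcm, hQPQ]
  · simp only [LinearMap.comp_apply, LinearMap.add_apply, LinearMap.sub_apply, LinearMap.id_apply,
      LinearMap.zero_apply, map_add, map_sub, hc]
    abel
  · simp only [LinearMap.comp_apply,
      LinearMap.add_apply, LinearMap.sub_apply, LinearMap.id_apply, LinearMap.zero_apply,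
      hbr_left, map_add, map_sub, hcm, ha, hP, hQ, hQPQ]
    abel

end Rigidity
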